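/- Let D : ℝ² → ℝ be a twice continuously differentiable function with 0 < D(x) ≤ D_m for all x and some constant D_m > 0, and let 𝐮 : ℝ² → ℝ² be a twice continuously differentiable vector field with compact support. Then the coercivity estimate ∫_{ℝ²} ℰ(𝐮)·𝐮 dx ≥ min(D_m^{-2}, 1/3) · ( ∫_{ℝ²} |D𝐮|² dx + ∫_{ℝ²} (∇·(D𝐮))² dx ) holds, i.e. the quadratic form of ℰ is coercive with respect to the weighted H(div)-seminorm ‖D𝐮‖²_{H(div)} = ‖D𝐮‖²_{L²} + ‖∇·(D𝐮)‖²_{L²}, with coercivity constant C_D^e = min(D_m^{-2}, 1/3). -/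

import Mathlib

open MeasureTheory

/-- Partial derivative in the `x`-direction of a scalar function on `ℝ²`. -/
noncomputable def pdx (f : ℝ × ℝ → ℝ) (x : ℝ × ℝ) : ℝ := fderiv ℝ f x (1, 0)

/-- Partial derivative in the `y`-direction of a scalar function on `ℝ²`. -/
noncomputable def pdy (f : ℝ × ℝ → ℝ) (x : ℝ × ℝ) : ℝ := fderiv ℝ f x (0, 1)

/-- Divergence `∇·𝐮 = ∂ₓu₁ + ∂_yu₂` of a vector field on `ℝ²`. -/
noncomputable def vdiv (u : ℝ × ℝ → ℝ × ℝ) (x : ℝ × ℝ) : ℝ :=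
  pdx (fun p => (u p).1) x + pdy (fun p => (u p).2) x

/-- Gradient `∇f = (∂ₓf, ∂_yf)` of a scalar function on `ℝ²`. -/
noncomputable def grad (f : ℝ × ℝ → ℝ) (x : ℝ × ℝ) : ℝ × ℝ := (pdx f x, pdy f x)

/-- Euclidean dot product on `ℝ²`. -/
def dot (a b : ℝ × ℝ) : ℝ := a.1 * b.1 + a.2 * b.2

/-- The Peregrine elliptic operator
`ℰ(𝐮) = 𝐮 − (1/2)·D·∇(∇·(D𝐮)) + (1/6)·D²·∇(∇·𝐮)`. -/
noncomputable def Eop (D : ℝ × ℝ → ℝ) (u : ℝ × ℝ → ℝ × ℝ) (x : ℝ × ℝ) : ℝ × ℝ :=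
  u x - ((1/2) * D x) • grad (vdiv (fun p => D p • u p)) x
      + ((1/6) * (D x)^2) • grad (vdiv u) x

theorem integral_fderiv_mul_of_hasCompactSupport {f g : ℝ × ℝ → ℝ} (hf : ContDiff ℝ 1 f)
    (hg : ContDiff ℝ 1 g) (hc : HasCompactSupport g) (v : ℝ × ℝ) :
    ∫ x, fderiv ℝ f x v * g x = -∫ x, f x * fderiv ℝ g x v := by
  have hf' : Continuous fun x => fderiv ℝ f x v :=
    (hf.continuous_fderiv one_ne_zero).clm_apply continuous_const
  have hg' : Continuous fun x => fderiv ℝ g x v :=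
    (hg.continuous_fderiv one_ne_zero).clm_apply continuous_const
  rw [integral_mul_fderiv_eq_neg_fderiv_mul_of_integrable, neg_neg]
  · exact (hf'.mul hg.continuous).integrable_of_hasCompactSupport hc.mul_left
  · exact (hf.continuous.mul hg').integrable_of_hasCompactSupport
      (hc.fderiv_apply (𝕜 := ℝ) v).mul_left
  · exact (hf.continuous.mul hg.continuous).integrable_of_hasCompactSupport hc.mul_left
  · exact fun x _ => hf.differentiable one_ne_zero x
  · exact fun x _ => hg.differentiable one_ne_zero x

theorem ContDiff.vdiv {u : ℝ × ℝ → ℝ × ℝ} {m n : WithTop ℕ∞} (hu : ContDiff ℝ n u)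
    (hmn : m + 1 ≤ n) : ContDiff ℝ m (vdiv u) :=
  ((hu.fst.fderiv_right hmn).clm_apply contDiff_const).add
    ((hu.snd.fderiv_right hmn).clm_apply contDiff_const)

theorem HasCompactSupport.vdiv {u : ℝ × ℝ → ℝ × ℝ} (hc : HasCompactSupport u) :
    HasCompactSupport (vdiv u) :=
  ((hc.comp_left (g := Prod.fst) rfl).fderiv_apply (𝕜 := ℝ) (1, 0)).add
    ((hc.comp_left (g := Prod.snd) rfl).fderiv_apply (𝕜 := ℝ) (0, 1))

theorem ContDiff.continuous_grad {f : ℝ × ℝ → ℝ} (hf : ContDiff ℝ 1 f) : Continuous (grad f) :=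
  ((hf.continuous_fderiv one_ne_zero).clm_apply continuous_const).prodMk
    ((hf.continuous_fderiv one_ne_zero).clm_apply continuous_const)

theorem integrable_dot {a b : ℝ × ℝ → ℝ × ℝ} (ha : Continuous a) (hb : Continuous b)
    (hc : HasCompactSupport b) : Integrable fun x => dot (a x) (b x) :=
  ((ha.fst.mul hb.fst).integrable_of_hasCompactSupport
    (hc.comp_left (g := Prod.fst) rfl).mul_left).add
  ((ha.snd.mul hb.snd).integrable_of_hasCompactSupport
    (hc.comp_left (g := Prod.snd) rfl).mul_left)

/-- Green's formula for a compactly supported vector field. -/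
theorem integral_dot_grad {f : ℝ × ℝ → ℝ} {u : ℝ × ℝ → ℝ × ℝ} (hf : ContDiff ℝ 1 f)
    (hu : ContDiff ℝ 1 u) (hc : HasCompactSupport u) :
    ∫ x, dot (grad f x) (u x) = -∫ x, f x * vdiv u x := by
  have hc1 : HasCompactSupport fun x => (u x).1 := hc.comp_left (g := Prod.fst) rfl
  have hc2 : HasCompactSupport fun x => (u x).2 := hc.comp_left (g := Prod.snd) rfl
  have hd {h : ℝ × ℝ → ℝ} (hh : ContDiff ℝ 1 h) (v : ℝ × ℝ) :
      Continuous fun x => fderiv ℝ h x v :=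
    (hh.continuous_fderiv one_ne_zero).clm_apply continuous_const
  simp only [dot, grad, vdiv, pdx, pdy, mul_add]
  rw [integral_add, integral_add, integral_fderiv_mul_of_hasCompactSupport hf hu.fst hc1,
    integral_fderiv_mul_of_hasCompactSupport hf hu.snd hc2]
  · ring
  · exact (hf.continuous.mul (hd hu.fst _)).integrable_of_hasCompactSupport
      (hc1.fderiv_apply (𝕜 := ℝ) _).mul_left
  · exact (hf.continuous.mul (hd hu.snd _)).integrable_of_hasCompactSupport
      (hc2.fderiv_apply (𝕜 := ℝ) _).mul_left
  · exact ((hd hf _).mul hu.continuous.fst).integrable_of_hasCompactSupport hc1.mul_left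
  · exact ((hd hf _).mul hu.continuous.snd).integrable_of_hasCompactSupport hc2.mul_left

theorem vdiv_smul {f : ℝ × ℝ → ℝ} {u : ℝ × ℝ → ℝ × ℝ} {x : ℝ × ℝ}
    (hf : DifferentiableAt ℝ f x) (hu : DifferentiableAt ℝ u x) :
    vdiv (fun p => f p • u p) x = f x * vdiv u x + dot (grad f x) (u x) := by
  simp only [vdiv, pdx, pdy, grad, dot, Prod.smul_fst, Prod.smul_snd, smul_eq_mul]
  rw [fderiv_fun_mul hf hu.fst, fderiv_fun_mul hf hu.snd]
  simp only [add_apply, smul_apply, smul_eq_mul]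
  ring

theorem dot_smul_left (c : ℝ) (a b : ℝ × ℝ) : dot (c • a) b = c * dot a b := by
  simp only [dot, Prod.smul_fst, Prod.smul_snd, smul_eq_mul]; ring

theorem dot_smul_right (c : ℝ) (a b : ℝ × ℝ) : dot a (c • b) = c * dot a b := by
  simp only [dot, Prod.smul_fst, Prod.smul_snd, smul_eq_mul]; ring

theorem dot_self_nonneg (a : ℝ × ℝ) : 0 ≤ dot a a :=
  add_nonneg (mul_self_nonneg _) (mul_self_nonneg _)

theorem dot_Eop (D : ℝ × ℝ → ℝ) (u : ℝ × ℝ → ℝ × ℝ) (x : ℝ × ℝ) :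
    dot (Eop D u x) (u x) = dot (u x) (u x)
      - 1 / 2 * dot (grad (vdiv fun p => D p • u p) x) (D x • u x)
      + 1 / 6 * dot (grad (vdiv u) x) (D x • D x • u x) := by
  simp only [Eop, dot, Prod.fst_add, Prod.snd_add, Prod.fst_sub, Prod.snd_sub, Prod.smul_fst,
    Prod.smul_snd, smul_eq_mul]
  ring

/-- coercivity of the quadratic form of `ℰ` with respect to the
weighted `H(div)`-seminorm, with constant `C_D^e = min(D_m⁻², 1/3)`. -/
theorem coercivity
    (D : ℝ × ℝ → ℝ) (Dm : ℝ) (hDm : 0 < Dm)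
    (hD : ContDiff ℝ 2 D)
    (hDpos : ∀ x, 0 < D x) (hDle : ∀ x, D x ≤ Dm)
    (u : ℝ × ℝ → ℝ × ℝ) (hu : ContDiff ℝ 2 u) (hsupp : HasCompactSupport u) :
    ∫ x, dot (Eop D u x) (u x)
      ≥ min (Dm^2)⁻¹ (1/3) *
        ((∫ x, dot (D x • u x) (D x • u x))
          + (∫ x, (vdiv (fun p => D p • u p) x)^2)) := by
  set v : ℝ × ℝ → ℝ × ℝ := fun p => D p • u p with hv
  have hvC : ContDiff ℝ 2 v := hD.smul hu
  have hvc : HasCompactSupport v := hsupp.smul_left (f := D)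
  have hzC : ContDiff ℝ 2 fun p => D p • v p := hD.smul hvC
  have hzc : HasCompactSupport fun p => D p • v p := hvc.smul_left (f := D)
  have hs : ContDiff ℝ 1 (vdiv u) := hu.vdiv (by norm_num)
  have hw : ContDiff ℝ 1 (vdiv v) := hvC.vdiv (by norm_num)
  have hz : ContDiff ℝ 1 (vdiv fun p => D p • v p) :=
    hzC.vdiv (by norm_num)
  have iu : Integrable fun x => dot (u x) (u x) :=
    integrable_dot hu.continuous hu.continuous hsupp
  have iv : Integrable fun x => dot (v x) (v x) :=
    integrable_dot hvC.continuous hvC.continuous hvc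
  have iw : Integrable fun x => vdiv v x * vdiv v x :=
    (hw.continuous.mul hw.continuous).integrable_of_hasCompactSupport hvc.vdiv.mul_left
  have iz : Integrable fun x => vdiv u x * vdiv (fun p => D p • v p) x :=
    (hs.continuous.mul hz.continuous).integrable_of_hasCompactSupport hzc.vdiv.mul_left
  have igw : Integrable fun x => dot (grad (vdiv v) x) (v x) :=
    integrable_dot hw.continuous_grad hvC.continuous hvc
  have igs : Integrable fun x => dot (grad (vdiv u) x) (D x • v x) :=
    integrable_dot hs.continuous_grad hzC.continuous hzc
  have iuw : Integrable fun x => dot (u x) (u x) + 1 / 2 * (vdiv v x * vdiv v x) :=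
    iu.add (iw.const_mul _)
  have iugw : Integrable fun x => dot (u x) (u x) - 1 / 2 * dot (grad (vdiv v) x) (v x) :=
    iu.sub (igw.const_mul _)
  have key : ∫ x, dot (Eop D u x) (u x) = ∫ x, (dot (u x) (u x)
      + 1 / 2 * (vdiv v x * vdiv v x)
      - 1 / 6 * (vdiv u x * vdiv (fun p => D p • v p) x)) := by
    rw [integral_sub iuw (iz.const_mul _),
      integral_add iu (iw.const_mul _), integral_const_mul, integral_const_mul]
    simp only [dot_Eop]
    rw [integral_add iugw (igs.const_mul _),
      integral_sub iu (igw.const_mul _), integral_const_mul, integral_const_mul,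
      integral_dot_grad hw (hvC.of_le one_le_two) hvc,
      integral_dot_grad hs (hzC.of_le one_le_two) hzc]
    ring
  simp only [pow_two (vdiv v _)]
  rw [key, ge_iff_le, ← integral_add iv iw, ← integral_const_mul]
  refine integral_mono ?_ ?_ fun x => ?_
  · exact (iv.add iw).const_mul _
  · exact iuw.sub (iz.const_mul _)
  have hDx : DifferentiableAt ℝ D x := hD.differentiable two_ne_zero x
  have ew : vdiv v x = D x * vdiv u x + dot (grad D x) (u x) :=
    vdiv_smul hDx (hu.differentiable two_ne_zero x)
  have ez : vdiv (fun p => D p • v p) x = D x * vdiv v x + D x * dot (grad D x) (u x) := by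
    rw [vdiv_smul hDx (hvC.differentiable two_ne_zero x), hv, dot_smul_right]
  have hmass : min (Dm ^ 2)⁻¹ (1 / 3) * dot (v x) (v x) ≤ dot (u x) (u x) := by
    have h : (Dm ^ 2)⁻¹ * D x ^ 2 ≤ 1 := by
      rw [inv_mul_le_one₀ (by positivity)]
      exact pow_le_pow_left₀ (hDpos x).le (hDle x) 2
    calc min (Dm ^ 2)⁻¹ (1 / 3) * dot (v x) (v x)
        ≤ (Dm ^ 2)⁻¹ * dot (v x) (v x) :=
          mul_le_mul_of_nonneg_right (min_le_left _ _) (dot_self_nonneg _)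
      _ = (Dm ^ 2)⁻¹ * D x ^ 2 * dot (u x) (u x) := by
          simp only [hv, dot_smul_left, dot_smul_right]; ring
      _ ≤ dot (u x) (u x) := mul_le_of_le_one_left (dot_self_nonneg _) h
  have hdiv : min (Dm ^ 2)⁻¹ (1 / 3) * (vdiv v x * vdiv v x)
      ≤ 1 / 3 * (vdiv v x * vdiv v x) :=
    mul_le_mul_of_nonneg_right (min_le_right _ _) (mul_self_nonneg _)
  have hcross : vdiv u x * vdiv (fun p => D p • v p) x
      = vdiv v x * vdiv v x - dot (grad D x) (u x) ^ 2 := by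
    rw [ez, ew]; ring
  beta_reduce
  rw [hcross, mul_add]
  nlinarith [sq_nonneg (dot (grad D x) (u x))]
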